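/- Let n ≥ 1, let 0 < a < b be reals, let λ_1, …, λ_n be real numbers, and let f : ℝ → ℝ be continuous on [a,b]. Define the operators M_k on functions y : ℝ → ℝ by M_0 y = y and (M_{k+1} y)(t) = t·(M_k y)'(t). Then there exists a constant K > 0 (depending only on n, a, b, and λ_1, …, λ_n) such that for every ε > 0 and every x : ℝ → ℝ with M_k x differentiable on [a,b] for k = 0, …, n−1 and satisfying |∑_{k=0}^n α_k (M_k x)(t) − f(t)| ≤ ε for all t ∈ [a,b], there exists u : ℝ → ℝ with M_k u differentiable on [a,b] for k = 0, …, n−1 such that ∑_{k=0}^n α_k (M_k u)(t) = f(t) for all t ∈ [a,b] and |x(t) − u(t)| ≤ K ε for all t ∈ [a,b]. (This is the classical n-th order Cauchy–Euler equation, the case φ(t) = t of the paper's main theorem on the time scale ℝ; note |φ(t)| = t ≥ a > 0 on [a,b].) -/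

import Mathlib

/-- The classical Cauchy–Euler operators: `M 0 y = y`, `(M (k+1) y) t = t · (M k y)' t`. -/
noncomputable def M : ℕ → (ℝ → ℝ) → (ℝ → ℝ)
  | 0, y => y
  | (k+1), y => fun t => t * deriv (M k y) t

/-- `alpha n lam k = e_{n-k}(-lam 1, …, -lam n)`, the `(n-k)`-th elementary
symmetric polynomial evaluated at `-lam 1, …, -lam n`. -/
noncomputable def alpha (n : ℕ) (lam : ℕ → ℝ) (k : ℕ) : ℝ :=
  ∑ S ∈ (Finset.Icc 1 n).powersetCard (n - k), ∏ i ∈ S, (-lam i)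

/-- The operator `∏ i ∈ [1, n], (t · d/dt - lam i)`, in expanded form. -/
noncomputable def eulerOp (lam : ℕ → ℝ) (n : ℕ) (y : ℝ → ℝ) (t : ℝ) : ℝ :=
  ∑ k ∈ Finset.range (n + 1), alpha n lam k * M k y t

lemma alpha_self (n : ℕ) (lam : ℕ → ℝ) : alpha n lam n = 1 := by
  simp [alpha]

lemma alpha_succ_zero (n : ℕ) (lam : ℕ → ℝ) :
    alpha (n + 1) lam 0 = -lam (n + 1) * alpha n lam 0 := by
  have h : ∀ m : ℕ, (Finset.Icc 1 m).powersetCard m = {Finset.Icc 1 m} := fun m => by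
    simpa using Finset.powersetCard_self (Finset.Icc 1 m)
  simp only [alpha, Nat.sub_zero, h, Finset.sum_singleton]
  rw [Finset.prod_Icc_succ_top (by omega), mul_comm]

lemma alpha_succ_succ {n k : ℕ} (hk : k < n) (lam : ℕ → ℝ) :
    alpha (n + 1) lam (k + 1) = alpha n lam k - lam (n + 1) * alpha n lam (k + 1) := by
  obtain ⟨m, rfl⟩ := Nat.exists_eq_add_of_lt hk
  have hnot : k + m + 1 + 1 ∉ Finset.Icc 1 (k + m + 1) := by simp
  have hIcc : Finset.Icc 1 (k + m + 1 + 1) =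
      insert (k + m + 1 + 1) (Finset.Icc 1 (k + m + 1)) := by
    ext i; simp only [Finset.mem_Icc, Finset.mem_insert]; omega
  have e1 : k + m + 1 + 1 - (k + 1) = m + 1 := by omega
  have e2 : k + m + 1 - k = m + 1 := by omega
  have e3 : k + m + 1 - (k + 1) = m := by omega
  have hmem : ∀ S ∈ (Finset.Icc 1 (k + m + 1)).powersetCard m, k + m + 1 + 1 ∉ S :=
    fun S hS h => hnot ((Finset.mem_powersetCard.1 hS).1 h)
  simp only [alpha, e1, e2, e3]
  rw [hIcc, Finset.powersetCard_succ_insert hnot, Finset.sum_union, Finset.sum_image,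
    Finset.mul_sum, sub_eq_add_neg, ← Finset.sum_neg_distrib]
  · congr 1
    refine Finset.sum_congr rfl fun S hS => ?_
    rw [Finset.prod_insert (hmem S hS)]
    ring
  · intro S hS T hT h
    rw [← Finset.erase_insert (hmem S hS), ← Finset.erase_insert (hmem T hT), h]
  · rw [Finset.disjoint_left]
    intro S hS hS'
    obtain ⟨T, -, rfl⟩ := Finset.mem_image.1 hS'
    exact hnot ((Finset.mem_powersetCard.1 hS).1 (Finset.mem_insert_self _ _))

lemma sum_alpha_succ (n : ℕ) (lam m : ℕ → ℝ) :
    ∑ k ∈ Finset.range (n + 2), alpha (n + 1) lam k * m k =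
      ∑ k ∈ Finset.range (n + 1), alpha n lam k * m (k + 1) -
        lam (n + 1) * ∑ k ∈ Finset.range (n + 1), alpha n lam k * m k := by
  rw [Finset.sum_range_succ, Finset.sum_range_succ',
    Finset.sum_range_succ (fun k => alpha n lam k * m (k + 1)),
    Finset.sum_range_succ' (fun k => alpha n lam k * m k), alpha_self, alpha_self,
    alpha_succ_zero, Finset.sum_congr rfl fun k hk => by
      rw [alpha_succ_succ (Finset.mem_range.1 hk) lam, sub_mul, mul_assoc (lam (n + 1))],
    Finset.sum_sub_distrib, ← Finset.mul_sum]
  ring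

lemma eulerOp_zero (lam : ℕ → ℝ) (y : ℝ → ℝ) : eulerOp lam 0 y = y := by
  ext t
  simp [eulerOp, alpha_self, M]

lemma eulerOp_hasDerivAt {lam : ℕ → ℝ} {n : ℕ} {y : ℝ → ℝ} {t : ℝ} (ht : t ≠ 0)
    (hy : ∀ k ≤ n, DifferentiableAt ℝ (M k y) t) :
    HasDerivAt (eulerOp lam n y)
      ((eulerOp lam (n + 1) y t + lam (n + 1) * eulerOp lam n y t) / t) t := by
  have h : HasDerivAt (eulerOp lam n y)
      (∑ k ∈ Finset.range (n + 1), alpha n lam k * deriv (M k y) t) t :=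
    HasDerivAt.fun_sum fun k hk =>
      (hy k (Nat.lt_succ_iff.1 (Finset.mem_range.1 hk))).hasDerivAt.const_mul _
  convert h using 1
  rw [div_eq_iff ht, Finset.sum_mul]
  simp only [eulerOp]
  rw [sum_alpha_succ, sub_add_cancel]
  refine Finset.sum_congr rfl fun k _ => ?_
  simp only [M]
  ring

lemma exists_first_order_euler_solution {a : ℝ} (ha : 0 < a) (l c : ℝ) {g : ℝ → ℝ}
    (hg : ContinuousOn g (Set.Ioi 0)) :
    ∃ v : ℝ → ℝ, v a = c ∧ ∀ t > 0, HasDerivAt v ((g t + l * v t) / t) t := by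
  have hpow : ∀ p : ℝ, ContinuousOn (fun s : ℝ => s ^ p) (Set.Ioi 0) := fun p s hs =>
    (Real.continuousAt_rpow_const s p (Or.inl (ne_of_gt hs))).continuousWithinAt
  have hh : ContinuousOn (fun s => s ^ (-l - 1) * g s) (Set.Ioi 0) := (hpow _).mul hg
  refine ⟨fun t => t ^ l * (c * a ^ (-l) + ∫ s in a..t, s ^ (-l - 1) * g s), ?_, ?_⟩
  · simp only [intervalIntegral.integral_same, add_zero]
    rw [Real.rpow_neg ha.le]
    field_simp [(Real.rpow_pos_of_pos ha l).ne']
  · intro t ht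
    have hint : HasDerivAt (fun t => ∫ s in a..t, s ^ (-l - 1) * g s)
        (t ^ (-l - 1) * g t) t := by
      refine intervalIntegral.integral_hasDerivAt_right ?_
        (hh.stronglyMeasurableAtFilter isOpen_Ioi t ht) (hh.continuousAt (Ioi_mem_nhds ht))
      refine (hh.mono fun s hs => ?_).intervalIntegrable
      exact (lt_min ha ht).trans_le hs.1
    have hp := Real.hasDerivAt_rpow_const (x := t) (p := l) (Or.inl ht.ne')
    refine (hp.mul (hint.const_add (c * a ^ (-l)))).congr_deriv ?_
    have htl := (Real.rpow_pos_of_pos ht l).ne'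
    rw [Real.rpow_sub_one ht.ne', Real.rpow_sub_one ht.ne', Real.rpow_neg ht.le]
    field_simp
    ring

lemma exists_euler_solution {a : ℝ} (ha : 0 < a) (lam c : ℕ → ℝ) (n : ℕ) {g : ℝ → ℝ}
    (hg : ContinuousOn g (Set.Ioi 0)) :
    ∃ u : ℝ → ℝ, (∀ k < n, ∀ t > 0, DifferentiableAt ℝ (M k u) t) ∧
      (∀ t > 0, eulerOp lam n u t = g t) ∧ ∀ j < n, eulerOp lam j u a = c j := by
  induction n generalizing g with
  | zero => exact ⟨g, by simp, by simp [eulerOp_zero], by simp⟩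
  | succ n ih =>
    obtain ⟨v, hva, hv⟩ := exists_first_order_euler_solution ha (lam (n + 1)) (c n) hg
    obtain ⟨u, hu, huv, huc⟩ := ih fun t ht => (hv t ht).continuousAt.continuousWithinAt
    have hdiff : ∀ k < n + 1, ∀ t > 0, DifferentiableAt ℝ (M k u) t := by
      intro k hk t ht
      rcases Nat.lt_succ_iff_lt_or_eq.1 hk with hk | rfl
      · exact hu k hk t ht
      · have hd : DifferentiableAt ℝ
            (fun s => v s - ∑ i ∈ Finset.range k, alpha k lam i * M i u s) t :=
          (hv t ht).differentiableAt.sub (DifferentiableAt.fun_sum fun i hi =>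
            (hu i (Finset.mem_range.1 hi) t ht).const_mul _)
        refine hd.congr_of_eventuallyEq ?_
        filter_upwards [Ioi_mem_nhds ht] with s hs
        rw [← huv s hs, eulerOp, Finset.sum_range_succ, alpha_self]
        ring
    refine ⟨u, hdiff, fun t ht => ?_, fun j hj => ?_⟩
    · have h1 := eulerOp_hasDerivAt (lam := lam) ht.ne'
        fun k hk => hdiff k (Nat.lt_succ_of_le hk) t ht
      have h2 := (hv t ht).congr_of_eventuallyEq
        (Filter.eventuallyEq_of_mem (Ioi_mem_nhds ht) huv)
      have h := h1.unique h2
      rw [div_left_inj' ht.ne', huv t ht] at h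
      exact add_right_cancel h
    · rcases Nat.lt_succ_iff_lt_or_eq.1 hj with hj | rfl
      · exact huc j hj
      · rw [huv a ha, hva]

lemma exists_first_order_euler_bound {a b : ℝ} (ha : 0 < a) (hab : a < b) (l : ℝ) :
    ∃ C > 0, ∀ ε > 0, ∀ w r : ℝ → ℝ, w a = 0 →
      (∀ t ∈ Set.Icc a b, HasDerivAt w ((r t + l * w t) / t) t) →
      (∀ t ∈ Set.Icc a b, |r t| ≤ ε) → ∀ t ∈ Set.Icc a b, |w t| ≤ C * ε := by
  set K : ℝ := |l| / a + 1 with hK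
  have hKpos : 0 < K := by positivity
  have hexp : 0 < Real.exp (K * (b - a)) - 1 :=
    sub_pos.2 (Real.one_lt_exp_iff.2 (mul_pos hKpos (sub_pos.2 hab)))
  refine ⟨(Real.exp (K * (b - a)) - 1) / (a * K), by positivity, ?_⟩
  intro ε hε w r hwa hw hr t ht
  have hbound : ∀ s ∈ Set.Ico a b, ‖(r s + l * w s) / s‖ ≤ K * ‖w s‖ + ε / a := by
    intro s hs
    have hs0 : 0 < s := ha.trans_le hs.1
    rw [Real.norm_eq_abs, Real.norm_eq_abs, abs_div, abs_of_pos hs0]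
    calc |r s + l * w s| / s ≤ (ε + |l| * |w s|) / a := by
          gcongr
          · exact (abs_add_le _ _).trans
              (add_le_add (hr s (Set.Ico_subset_Icc_self hs)) (abs_mul _ _).le)
          · exact hs.1
      _ = |l| / a * |w s| + ε / a := by ring
      _ ≤ K * |w s| + ε / a := by
          rw [hK]
          gcongr
          linarith
  have h := norm_le_gronwallBound_of_norm_deriv_right_le (δ := 0)
    (fun s hs => (hw s hs).continuousAt.continuousWithinAt)
    (fun s hs => (hw s (Set.Ico_subset_Icc_self hs)).hasDerivWithinAt)
    (by simp [hwa]) hbound t ht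
  rw [gronwallBound_of_K_ne_0 hKpos.ne'] at h
  simp only [zero_mul, zero_add] at h
  calc |w t| ≤ ε / a / K * (Real.exp (K * (t - a)) - 1) := h
    _ ≤ ε / a / K * (Real.exp (K * (b - a)) - 1) := by
        gcongr
        exact ht.2
    _ = _ := by field_simp

lemma exists_euler_chain_bound {a b : ℝ} (ha : 0 < a) (hab : a < b) (lam : ℕ → ℝ) (n : ℕ) :
    ∃ C > 0, ∀ ε > 0, ∀ w : ℕ → ℝ → ℝ, (∀ j < n, w j a = 0) →
      (∀ j < n, ∀ t ∈ Set.Icc a b,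
        HasDerivAt (w j) ((w (j + 1) t + lam (j + 1) * w j t) / t) t) →
      (∀ t ∈ Set.Icc a b, |w n t| ≤ ε) → ∀ t ∈ Set.Icc a b, |w 0 t| ≤ C * ε := by
  induction n with
  | zero => exact ⟨1, one_pos, fun ε _ w _ _ h => by simpa using h⟩
  | succ n ih =>
    obtain ⟨C, hC, h⟩ := ih
    obtain ⟨D, hD, h'⟩ := exists_first_order_euler_bound ha hab (lam (n + 1))
    refine ⟨C * D, mul_pos hC hD, fun ε hε w hwa hw hwn t ht => ?_⟩
    rw [mul_assoc]
    exact h (D * ε) (mul_pos hD hε) w (fun j hj => hwa j (by omega))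
      (fun j hj => hw j (by omega))
      (h' ε hε (w n) (w (n + 1)) (hwa n (by omega)) (hw n (by omega)) hwn) t ht

/-- Hyers–Ulam stability of the classical n-th order Cauchy–Euler equation
(the case φ(t) = t of the main theorem, time scale ℝ). -/
theorem hyers_ulam_classical_cauchy_euler (n : ℕ) (hn : 1 ≤ n) (a b : ℝ)
    (ha : 0 < a) (hab : a < b) (lam : ℕ → ℝ)
    (f : ℝ → ℝ) (hf : ContinuousOn f (Set.Icc a b)) :
    ∃ K > 0, ∀ ε > 0, ∀ x : ℝ → ℝ,
      (∀ k < n, ∀ t ∈ Set.Icc a b, DifferentiableAt ℝ (M k x) t) →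
      (∀ t ∈ Set.Icc a b,
          |∑ k ∈ Finset.range (n + 1), alpha n lam k * M k x t - f t| ≤ ε) →
      ∃ u : ℝ → ℝ,
        (∀ k < n, ∀ t ∈ Set.Icc a b, DifferentiableAt ℝ (M k u) t) ∧
        (∀ t ∈ Set.Icc a b,
            ∑ k ∈ Finset.range (n + 1), alpha n lam k * M k u t = f t) ∧
        (∀ t ∈ Set.Icc a b, |x t - u t| ≤ K * ε) := by
  obtain ⟨C, hC, hbound⟩ := exists_euler_chain_bound ha hab lam n
  refine ⟨C, hC, fun ε hε x hx hxf => ?_⟩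
  obtain ⟨u, hu, huf, hua⟩ := exists_euler_solution ha lam (fun j => eulerOp lam j x a) n
    (g := Set.IccExtend hab.le ((Set.Icc a b).domRestrict f))
    (continuousOn_iff_continuous_domRestrict.1 hf).Icc_extend'.continuousOn
  have hpos : ∀ t ∈ Set.Icc a b, 0 < t := fun t ht => ha.trans_le ht.1
  have hufI : ∀ t ∈ Set.Icc a b, eulerOp lam n u t = f t := fun t ht => by
    rw [huf t (hpos t ht), Set.IccExtend_of_mem _ _ ht, Set.domRestrict_apply]
  refine ⟨u, fun k hk t ht => hu k hk t (hpos t ht), hufI, ?_⟩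
  have h := hbound ε hε (fun j t => eulerOp lam j x t - eulerOp lam j u t)
    (fun j hj => by simp [hua j hj]) (fun j hj t ht => ?_) (fun t ht => ?_)
  · simpa only [eulerOp_zero] using h
  · have h1 := eulerOp_hasDerivAt (lam := lam) (hpos t ht).ne'
      fun k (hk : k ≤ j) => hx k (hk.trans_lt hj) t ht
    have h2 := eulerOp_hasDerivAt (lam := lam) (hpos t ht).ne'
      fun k (hk : k ≤ j) => hu k (hk.trans_lt hj) t (hpos t ht)
    exact (h1.sub h2).congr_deriv (by ring)
  · rw [hufI t ht]
    exact hxf t ht
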